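/- arXiv:math/0407101 — 3 statements merged into one kernel-verified Lean document; each statement's English description precedes it below -/
import Mathlib

section
/- Residue recursion for the type D_r diamond functions: let r≥5 and let i, j satisfy 4≤i<j≤r. Then, for every choice of the variables other than x := t^{(i)}_2 lying outside a finite union of affine hyperplanes, the rational function x·δ_{i,j} extends regularly to x=0 and lim_{x→0} x·δ_{i,j} = δ_{i−1,j}, where on the right the remaining color-i variable t^{(i)}_1 of δ_{i,j} serves as the single color-i variable of δ_{i−1,j}. -/
open Finset Filter Topology

/-- The set of variables `t⁽ⁱ⁾_a`, `1 ≤ i ≤ r`, `1 ≤ a ≤ k i`. -/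
abbrev SVars (r : ℕ) (k : Fin r → ℕ) := (i : Fin r) × Fin (k i)

/-- Extend an assignment of all variables other than `v0` by assigning `x` to `v0`. -/
noncomputable def extendAt (r : ℕ) (k : Fin r → ℕ) (v0 : SVars r k)
    (s : {v : SVars r k // v ≠ v0} → ℂ) (x : ℂ) : SVars r k → ℂ :=
  fun v => if h : v = v0 then x else s ⟨v, h⟩

/-- View a variable for the smaller content `k'` as one of the variables `≠ v0` for the
content `k`. -/
def restrictVar (r : ℕ) (k k' : Fin r → ℕ) (hk : ∀ i, k' i ≤ k i) (v0 : SVars r k)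
    (hv0 : k' v0.1 ≤ (v0.2 : ℕ)) (v : SVars r k') : {w : SVars r k // w ≠ v0} :=
  ⟨⟨v.1, ⟨(v.2 : ℕ), lt_of_lt_of_le v.2.isLt (hk v.1)⟩⟩, by
    intro hEq
    have h1 : v.1 = v0.1 := congrArg Sigma.fst hEq
    have h2 := (Sigma.ext_iff.mp hEq).2
    have h3 : ((v.2 : ℕ)) = (v0.2 : ℕ) :=
      (Fin.heq_ext_iff (congrArg k h1)).mp h2
    have h4 : (v.2 : ℕ) < k' v.1 := v.2.isLt
    have h5 : k' v.1 = k' v0.1 := congrArg k' h1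
    omega⟩

/-- The value of the variable `t⁽ᶜ⁾_a` (`1`-based color `c` and lower index `a`), after
applying the permutation `π ∈ G_k` to the lower indices, at the point `t`. -/
noncomputable def tvp (r : ℕ) (k : Fin r → ℕ) (π : ∀ i, Equiv.Perm (Fin (k i)))
    (t : SVars r k → ℂ) (c a : ℕ) : ℂ :=
  if h : c - 1 < r then
    if h2 : a - 1 < k ⟨c - 1, h⟩ then t ⟨⟨c - 1, h⟩, (π ⟨c - 1, h⟩) ⟨a - 1, h2⟩⟩ else 0
  else 0

/-- The content `c(i,j) = (1, 1, 2^{i−2}, 1^{j−i}, 0^{r−j})` (1-based colors). -/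
def contD (r i j : ℕ) : Fin r → ℕ :=
  fun u => if (u : ℕ) + 1 ≤ 2 then 1 else if (u : ℕ) + 1 ≤ i then 2
    else if (u : ℕ) + 1 ≤ j then 1 else 0

/-- The type `D_r` diamond function `δ_{i,j} = η_{ε_j+ε_i}`. -/
noncomputable def deltaD (r i j : ℕ) (t : SVars r (contD r i j) → ℂ) : ℂ :=
  ∑ π : ∀ u, Equiv.Perm (Fin (contD r i j u)),
    (tvp r _ π t 3 1 - tvp r _ π t 3 2) /
      (tvp r _ π t i 2 *
        (∏ u ∈ Finset.Icc 3 (i - 1), (tvp r _ π t u 2 - tvp r _ π t (u + 1) 2)) *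
        ((tvp r _ π t 1 1 - tvp r _ π t 3 2) *
          ((tvp r _ π t 2 1 - tvp r _ π t 3 2) *
            ((tvp r _ π t 3 1 - tvp r _ π t 1 1) *
              (tvp r _ π t 3 1 - tvp r _ π t 2 1)))) *
        (∏ u ∈ Finset.Icc 4 j, (tvp r _ π t u 1 - tvp r _ π t (u - 1) 1)))

/-- A permuted variable whose position is not `v0` does not depend on the value at `v0`. -/
lemma tvp_extendAt_eq_or (r : ℕ) (k : Fin r → ℕ) (v0 : SVars r k)
    (s : {v : SVars r k // v ≠ v0} → ℂ) (π : ∀ u, Equiv.Perm (Fin (k u))) (c a : ℕ) :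
    (c - 1 = v0.1 ∧ ∀ x, tvp r k π (extendAt r k v0 s x) c a = x) ∨
      ∀ x, tvp r k π (extendAt r k v0 s x) c a = tvp r k π (extendAt r k v0 s 0) c a := by
  by_cases h : c - 1 < r
  · by_cases h2 : a - 1 < k ⟨c - 1, h⟩
    · by_cases hv : (⟨⟨c - 1, h⟩, (π ⟨c - 1, h⟩) ⟨a - 1, h2⟩⟩ : SVars r k) = v0
      · refine Or.inl ⟨by rw [← hv], fun x => ?_⟩
        simp [tvp, h, h2, extendAt, hv]
      · exact Or.inr fun x => by simp [tvp, h, h2, extendAt, hv]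
    · exact Or.inr fun x => by simp [tvp, h, h2]
  · exact Or.inr fun x => by simp [tvp, h]

lemma tvp_extendAt_of_ne (r : ℕ) (k : Fin r → ℕ) (v0 : SVars r k)
    (s : {v : SVars r k // v ≠ v0} → ℂ) (π : ∀ u, Equiv.Perm (Fin (k u))) {c : ℕ}
    (hc : c - 1 ≠ v0.1) (a : ℕ) (x : ℂ) :
    tvp r k π (extendAt r k v0 s x) c a = tvp r k π (extendAt r k v0 s 0) c a :=
  (tvp_extendAt_eq_or r k v0 s π c a).elim (fun h => absurd h.1 hc) (fun h => h x)

lemma tvp_extendAt_ne_zero (r : ℕ) (k : Fin r → ℕ) (v0 : SVars r k)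
    (s : {v : SVars r k // v ≠ v0} → ℂ) (hs : ∀ v, s v ≠ 0)
    (π : ∀ u, Equiv.Perm (Fin (k u))) {c a : ℕ} (hc : c - 1 ≠ v0.1) (h : c - 1 < r)
    (h2 : a - 1 < k ⟨c - 1, h⟩) (x : ℂ) :
    tvp r k π (extendAt r k v0 s x) c a ≠ 0 := by
  have hv : (⟨⟨c - 1, h⟩, (π ⟨c - 1, h⟩) ⟨a - 1, h2⟩⟩ : SVars r k) ≠ v0 := by
    intro hv
    exact hc (by rw [← hv])
  simp only [tvp, h, h2, extendAt, hv, dite_true, dite_false]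
  exact hs _

lemma continuousAt_tvp_extendAt (r : ℕ) (k : Fin r → ℕ) (v0 : SVars r k)
    (s : {v : SVars r k // v ≠ v0} → ℂ) (π : ∀ u, Equiv.Perm (Fin (k u))) (c a : ℕ) :
    ContinuousAt (fun x => tvp r k π (extendAt r k v0 s x) c a) 0 := by
  rcases tvp_extendAt_eq_or r k v0 s π c a with h | h
  · simp only [h.2]
    exact continuousAt_id
  · rw [funext h]
    exact continuousAt_const

/-- The inverse of a difference of variables of two distinct colors is regular at `0` as soon as
the one whose color differs from that of `v0` is nonzero whenever the other has color `v0.1`. -/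
lemma continuousAt_inv_tvp_sub (r : ℕ) (k : Fin r → ℕ) (v0 : SVars r k)
    (s : {v : SVars r k // v ≠ v0} → ℂ) (π : ∀ u, Equiv.Perm (Fin (k u))) (c a c' a' : ℕ)
    (h : c - 1 = v0.1 → c' - 1 ≠ v0.1 ∧ tvp r k π (extendAt r k v0 s 0) c' a' ≠ 0)
    (h' : c' - 1 = v0.1 → c - 1 ≠ v0.1 ∧ tvp r k π (extendAt r k v0 s 0) c a ≠ 0) :
    ContinuousAt (fun x => (tvp r k π (extendAt r k v0 s x) c a -
      tvp r k π (extendAt r k v0 s x) c' a')⁻¹) 0 := by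
  have hcont := (continuousAt_tvp_extendAt r k v0 s π c a).sub
    (continuousAt_tvp_extendAt r k v0 s π c' a')
  rcases tvp_extendAt_eq_or r k v0 s π c a with h1 | h1
  · refine hcont.inv₀ ?_
    simpa [h1.2 0] using (h h1.1).2
  · rcases tvp_extendAt_eq_or r k v0 s π c' a' with h2 | h2
    · refine hcont.inv₀ ?_
      simpa [h2.2 0] using (h' h2.1).2
    · have : (fun x => (tvp r k π (extendAt r k v0 s x) c a -
          tvp r k π (extendAt r k v0 s x) c' a')⁻¹) = fun _ =>
          (tvp r k π (extendAt r k v0 s 0) c a - tvp r k π (extendAt r k v0 s 0) c' a')⁻¹ :=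
        funext fun x => by rw [h1 x, h2 x]
      rw [this]
      exact continuousAt_const

/-- Extend permutations of the lower indices for the content `k'` by the identity. -/
noncomputable def extendPerm (r : ℕ) (k k' : Fin r → ℕ) (hk : ∀ u, k' u ≤ k u)
    (π : ∀ u, Equiv.Perm (Fin (k' u))) : ∀ u, Equiv.Perm (Fin (k u)) :=
  fun u => (π u).viaEmbedding (Fin.castLEEmb (hk u))

lemma extendPerm_castLE (r : ℕ) (k k' : Fin r → ℕ) (hk : ∀ u, k' u ≤ k u)
    (π : ∀ u, Equiv.Perm (Fin (k' u))) (u : Fin r) (b : Fin (k' u)) :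
    extendPerm r k k' hk π u (Fin.castLE (hk u) b) = Fin.castLE (hk u) (π u b) :=
  Equiv.Perm.viaEmbedding_apply (π u) (Fin.castLEEmb (hk u)) b

lemma extendPerm_of_le (r : ℕ) (k k' : Fin r → ℕ) (hk : ∀ u, k' u ≤ k u)
    (π : ∀ u, Equiv.Perm (Fin (k' u))) (u : Fin r) (b : Fin (k u)) (hb : k' u ≤ b) :
    extendPerm r k k' hk π u b = b := by
  refine Equiv.Perm.viaEmbedding_apply_of_notMem (π u) (Fin.castLEEmb (hk u)) b ?_
  rintro ⟨d, rfl⟩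
  have := d.isLt
  simp at hb
  omega

lemma extendPerm_injective (r : ℕ) (k k' : Fin r → ℕ) (hk : ∀ u, k' u ≤ k u) :
    Function.Injective (extendPerm r k k' hk) := by
  intro π σ h
  funext u
  ext b
  have := congrArg (fun p => p u (Fin.castLE (hk u) b)) h
  simp only [extendPerm_castLE] at this
  exact congrArg (fun d => d.val) this

/-- If `k` and `k'` differ at most in the color of `v0`, where they are `2` and `1`, the
permutations extended from `k'` include all those that fix `v0`. -/
lemma mem_range_extendPerm (r : ℕ) (k k' : Fin r → ℕ) (hk : ∀ u, k' u ≤ k u) (u0 : Fin r)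
    (hne : ∀ u, u ≠ u0 → k u = k' u) (h2 : k u0 = k' u0 + 1)
    (π : ∀ u, Equiv.Perm (Fin (k u)))
    (hπ : π u0 ⟨k' u0, by omega⟩ = ⟨k' u0, by omega⟩) :
    π ∈ Set.range (extendPerm r k k' hk) := by
  have hlt : ∀ u (b : Fin (k u)), (b : ℕ) < k' u → (π u b : ℕ) < k' u := by
    intro u b hb
    have h1 := (π u b).isLt
    by_cases hu : u = u0
    · subst hu
      by_contra hcon
      have h3 : π u b = ⟨k' u, by omega⟩ := Fin.ext (by simp only; omega)
      rw [← hπ] at h3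
      have := congrArg Fin.val ((π u).injective h3)
      simp only at this
      omega
    · have := hne u hu
      omega
  have hinj : ∀ u, Function.Injective (fun b : Fin (k' u) =>
      (⟨π u (Fin.castLE (hk u) b), hlt u _ b.isLt⟩ : Fin (k' u))) := by
    intro u b d hbd
    have h1 : (π u (Fin.castLE (hk u) b) : ℕ) = π u (Fin.castLE (hk u) d) :=
      congrArg (fun e : Fin (k' u) => (e : ℕ)) hbd
    exact Fin.castLE_injective (hk u) ((π u).injective (Fin.ext h1))
  refine ⟨fun u => Equiv.ofBijective _ (Finite.injective_iff_bijective.mp (hinj u)), ?_⟩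
  funext u
  refine Equiv.ext fun b => ?_
  by_cases hb : (b : ℕ) < k' u
  · exact (extendPerm_castLE r k k' hk _ u ⟨b, hb⟩).trans (Fin.ext rfl)
  · rw [extendPerm_of_le _ _ _ _ _ _ _ (not_lt.mp hb)]
    have hb2 := b.isLt
    have hu : u = u0 := by
      by_contra hu
      have := hne u hu
      omega
    subst hu
    have : b = ⟨k' u, by omega⟩ := Fin.ext (by simp only; omega)
    rw [this, hπ]

lemma tvp_extendPerm (r : ℕ) (k k' : Fin r → ℕ) (hk : ∀ u, k' u ≤ k u) (v0 : SVars r k)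
    (hv0 : k' v0.1 ≤ (v0.2 : ℕ)) (hne : ∀ u, u ≠ v0.1 → k u = k' u)
    (h2 : k v0.1 = k' v0.1 + 1) (s : {v : SVars r k // v ≠ v0} → ℂ)
    (π : ∀ u, Equiv.Perm (Fin (k' u))) (c a : ℕ) :
    tvp r k (extendPerm r k k' hk π) (extendAt r k v0 s 0) c a =
      tvp r k' π (fun v => s (restrictVar r k k' hk v0 hv0 v)) c a := by
  by_cases h : c - 1 < r
  swap
  · simp [tvp, h]
  by_cases ha' : a - 1 < k' ⟨c - 1, h⟩
  · have ha : a - 1 < k ⟨c - 1, h⟩ := ha'.trans_le (hk _)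
    simp only [tvp, h, ha, ha', dite_true]
    have h3 := extendPerm_castLE r k k' hk π ⟨c - 1, h⟩ ⟨a - 1, ha'⟩
    rw [Fin.castLE_mk] at h3
    rw [h3]
    exact dif_neg (restrictVar r k k' hk v0 hv0 ⟨⟨c - 1, h⟩, π _ ⟨a - 1, ha'⟩⟩).2
  · simp only [tvp, h, ha', dite_true, dite_false]
    split_ifs with ha
    · rw [extendPerm_of_le _ _ _ _ _ _ _ (not_lt.mp ha')]
      refine dif_pos ?_
      obtain ⟨u0, b0⟩ := v0
      have hu : (⟨c - 1, h⟩ : Fin r) = u0 := by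
        by_contra hu
        have := hne _ hu
        omega
      subst hu
      have := b0.isLt
      simp only at hv0 h2
      congr 1
      exact Fin.ext (by simp only; omega)
    · rfl

/-- residue recursion for the type `D_r` diamond functions: for `r ≥ 5` and
`4 ≤ i < j ≤ r`, generically in the variables other than `x := t^{(i)}_2`, the function
`x·δ_{i,j}` extends regularly to `x = 0` with limit `δ_{i−1,j}` (the remaining color-`i`
variable `t^{(i)}_1` serving as the single color-`i` variable of `δ_{i−1,j}`). -/
theorem residue_recursion_D_diamond (r : ℕ) (hr : 5 ≤ r) (i j : ℕ)
    (hi : 4 ≤ i) (hij : i < j) (hj : j ≤ r) :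
    ∃ N : Finset ((({v : SVars r (contD r i j) //
          v ≠ ⟨⟨i - 1, by omega⟩, ⟨1, by simp only [contD]; split_ifs <;> omega⟩⟩} → ℂ)
            →ₗ[ℂ] ℂ) × ℂ),
      (∀ q ∈ N, q.1 ≠ 0) ∧
      ∀ s : {v : SVars r (contD r i j) //
          v ≠ ⟨⟨i - 1, by omega⟩, ⟨1, by simp only [contD]; split_ifs <;> omega⟩⟩} → ℂ,
        (∀ q ∈ N, q.1 s ≠ q.2) →
        Tendsto
          (fun x : ℂ => x * deltaD r i j (extendAt r (contD r i j) _ s x))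
          (𝓝[≠] (0 : ℂ))
          (𝓝 (deltaD r (i - 1) j (fun v => s (restrictVar r (contD r i j) (contD r (i - 1) j)
            (by intro u; simp only [contD]; split_ifs <;> omega)
            ⟨⟨i - 1, by omega⟩, ⟨1, by simp only [contD]; split_ifs <;> omega⟩⟩
            (by simp only [contD]; split_ifs <;> omega) v)))) := by
  classical
  have hk : ∀ u, contD r (i - 1) j u ≤ contD r i j u := by
    intro u; simp only [contD]; split_ifs <;> omega
  set v0 : SVars r (contD r i j) :=
    ⟨⟨i - 1, by omega⟩, ⟨1, by simp only [contD]; split_ifs <;> omega⟩⟩ with hv0def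
  have hv01 : (v0.1 : ℕ) = i - 1 := rfl
  have hv0' : contD r (i - 1) j v0.1 = 1 := by
    simp only [contD, hv01]; split_ifs <;> omega
  have hv0'' : contD r i j v0.1 = contD r (i - 1) j v0.1 + 1 := by
    simp only [contD, hv01]; split_ifs <;> omega
  have hv0 : contD r (i - 1) j v0.1 ≤ (v0.2 : ℕ) := hv0'.le
  have hne : ∀ u, u ≠ v0.1 → contD r i j u = contD r (i - 1) j u := by
    intro u hu
    have : (u : ℕ) ≠ i - 1 := fun h => hu (Fin.ext h)
    simp only [contD]; split_ifs <;> omega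
  refine ⟨Finset.univ.image fun v => (LinearMap.proj v, 0), ?_, ?_⟩
  · intro q hq
    obtain ⟨v, -, rfl⟩ := Finset.mem_image.mp hq
    intro h
    have := LinearMap.congr_fun h (fun _ => (1 : ℂ))
    simp at this
  intro s hs
  have hs0 : ∀ v, s v ≠ 0 := fun v =>
    hs (LinearMap.proj v, 0) (Finset.mem_image_of_mem _ (Finset.mem_univ v))
  let T (π : ∀ u, Equiv.Perm (Fin (contD r i j u))) (c a : ℕ) (x : ℂ) : ℂ :=
    tvp r (contD r i j) π (extendAt r (contD r i j) v0 s x) c a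
  let R (π : ∀ u, Equiv.Perm (Fin (contD r i j u))) (x : ℂ) : ℂ :=
    (∏ u ∈ Finset.Icc 3 (i - 1), (T π u 2 x - T π (u + 1) 2 x)) *
        ((T π 1 1 x - T π 3 2 x) * ((T π 2 1 x - T π 3 2 x) *
            ((T π 3 1 x - T π 1 1 x) * (T π 3 1 x - T π 2 1 x)))) *
        (∏ u ∈ Finset.Icc 4 j, (T π u 1 x - T π (u - 1) 1 x))
  have hTR : ∀ x, deltaD r i j (extendAt r (contD r i j) v0 s x) =
      ∑ π, (T π 3 1 x - T π 3 2 x) * (T π i 2 x)⁻¹ * (R π x)⁻¹ := by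
    intro x
    refine Finset.sum_congr rfl fun π _ => ?_
    simp only [T, R, div_eq_mul_inv, mul_inv]
    ring
  have hnonzero : ∀ π c a, c - 1 ≠ i - 1 → ∀ h : c - 1 < r,
      a - 1 < contD r i j ⟨c - 1, h⟩ → T π c a 0 ≠ 0 := fun π c a hc h h2 =>
    tvp_extendAt_ne_zero r _ v0 s hs0 π hc h h2 0
  have hR : ∀ π, ContinuousAt (fun x => (R π x)⁻¹) 0 := by
    intro π
    have hsub := continuousAt_inv_tvp_sub r (contD r i j) v0 s π
    have hsub' : ∀ c a c' a', c < i → c' < i →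
        ContinuousAt (fun x => (T π c a x - T π c' a' x)⁻¹) 0 := by
      intro c a c' a' hc hc'
      exact hsub c a c' a' (fun h => absurd h (by omega)) (fun h => absurd h (by omega))
    simp only [R, mul_inv, ← Finset.prod_inv_distrib]
    refine ContinuousAt.mul (ContinuousAt.mul ?_ ?_) ?_
    · refine tendsto_finsetProd _ fun u hu => ?_
      rw [Finset.mem_Icc] at hu
      refine hsub u 2 (u + 1) 2 (fun h => absurd h (by omega)) (fun h => ⟨by omega, ?_⟩)
      refine hnonzero π u 2 (by omega) (by omega) ?_
      simp only [contD]; split_ifs <;> omega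
    · exact (hsub' _ _ _ _ (by omega) (by omega)).mul ((hsub' _ _ _ _ (by omega) (by omega)).mul
        ((hsub' _ _ _ _ (by omega) (by omega)).mul (hsub' _ _ _ _ (by omega) (by omega))))
    · refine tendsto_finsetProd _ fun u hu => ?_
      rw [Finset.mem_Icc] at hu
      refine hsub u 1 (u - 1) 1 (fun h => ⟨by omega, ?_⟩) (fun h => ⟨by omega, ?_⟩)
      · refine hnonzero π (u - 1) 1 (by omega) (by omega) ?_
        simp only [contD]; split_ifs <;> omega
      · refine hnonzero π u 1 (by omega) (by omega) ?_
        simp only [contD]; split_ifs <;> omega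
  have hnum : ∀ π, ContinuousAt (fun x => T π 3 1 x - T π 3 2 x) 0 := fun π =>
    (continuousAt_tvp_extendAt r _ v0 s π 3 1).sub (continuousAt_tvp_extendAt r _ v0 s π 3 2)
  have hi2 : ∀ π x, T π i 2 x =
      extendAt r (contD r i j) v0 s x ⟨v0.1, π v0.1 v0.2⟩ := by
    intro π x
    have h1 : i - 1 < r := by omega
    have h2 : 2 - 1 < contD r i j ⟨i - 1, h1⟩ := v0.2.isLt
    simp only [T, tvp, h1, h2, dite_true]
    rfl
  let L (π : ∀ u, Equiv.Perm (Fin (contD r i j u))) : ℂ :=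
    if π v0.1 v0.2 = v0.2 then (T π 3 1 0 - T π 3 2 0) * (R π 0)⁻¹ else 0
  have hlim : Tendsto (fun x : ℂ => x * deltaD r i j (extendAt r (contD r i j) v0 s x))
      (𝓝[≠] (0 : ℂ)) (𝓝 (∑ π, L π)) := by
    simp only [hTR, Finset.mul_sum]
    refine tendsto_finsetSum _ fun π _ => ?_
    have hcont := (hnum π).mul (hR π)
    by_cases hπ : π v0.1 v0.2 = v0.2
    · simp only [L, if_pos hπ]
      refine (hcont.tendsto.mono_left nhdsWithin_le_nhds).congr' ?_
      filter_upwards [self_mem_nhdsWithin] with x hx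
      have hx0 : x ≠ 0 := hx
      have : T π i 2 x = x := by
        rw [hi2, hπ]
        exact dif_pos rfl
      simp only [this, Pi.mul_apply]
      field_simp
    · simp only [L, if_neg hπ]
      have hc : ∀ x, T π i 2 x = T π i 2 0 := by
        intro x
        have hv : (⟨v0.1, π v0.1 v0.2⟩ : SVars r (contD r i j)) ≠ v0 := by
          intro hv
          exact hπ (eq_of_heq (Sigma.ext_iff.mp hv).2)
        rw [hi2, hi2]
        simp only [extendAt, hv, dite_false]
      have h3 := (continuousAt_id (x := (0 : ℂ))).mul
        (((hnum π).mul (continuousAt_const (y := (T π i 2 0)⁻¹))).mul (hR π))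
      simp only [hc]
      have h4 := h3.tendsto.mono_left (nhdsWithin_le_nhds (s := {(0 : ℂ)}ᶜ))
      simp only [Pi.mul_apply, id_eq, zero_mul] at h4
      exact h4
  suffices h : deltaD r (i - 1) j (fun v => s (restrictVar r _ _ hk v0 hv0 v)) = ∑ π, L π by
    rw [← h] at hlim
    exact hlim
  refine Fintype.sum_of_injective (extendPerm r _ _ hk) (extendPerm_injective r _ _ hk) _ _ ?_ ?_
  · intro π hπ
    refine if_neg fun h => hπ ?_
    refine mem_range_extendPerm r _ _ hk v0.1 hne hv0'' π ?_
    have : v0.2 = ⟨contD r (i - 1) j v0.1, by omega⟩ := Fin.ext hv0'.symm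
    rw [← this, h]
  · intro π
    have hfix : extendPerm r _ _ hk π v0.1 v0.2 = v0.2 :=
      extendPerm_of_le _ _ _ _ _ _ _ hv0
    have hT : ∀ c a, tvp r _ π (fun v => s (restrictVar r _ _ hk v0 hv0 v)) c a =
        T (extendPerm r _ _ hk π) c a 0 := fun c a =>
      (tvp_extendPerm r _ _ hk v0 hv0 hne hv0'' s π c a).symm
    have hzero : T (extendPerm r _ _ hk π) (i - 1 + 1) 2 0 = 0 := by
      rw [Nat.sub_add_cancel (by omega), hi2, hfix]
      exact dif_pos rfl
    have hIcc : Finset.Icc 3 (i - 1) = insert (i - 1) (Finset.Icc 3 (i - 1 - 1)) := by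
      ext u
      simp only [Finset.mem_Icc, Finset.mem_insert]
      omega
    have hnot : i - 1 ∉ Finset.Icc 3 (i - 1 - 1) := by
      simp only [Finset.mem_Icc]
      omega
    simp only [hT, L, if_pos hfix, R]
    rw [hIcc, Finset.prod_insert hnot, hzero, sub_zero, div_eq_mul_inv]
end

section
/- Equality of the two expressions for the canonical differential form (one-color case): let n≥1 and let t_1,…,t_n be nonzero, pairwise distinct complex numbers. In the exterior algebra of ℂ^n with standard basis e_1,…,e_n, setting t_{σ(0)} := 0 and e_{σ(0)} := 0, one has Σ_{σ∈S_n} sgn(σ) · ⋀_{u=1}^{n} ( 1/(t_{σ(u)}−t_{σ(u−1)}) ) (e_{σ(u)} − e_{σ(u−1)}) = ( Σ_{σ∈S_n} ∏_{u=1}^{n} 1/(t_{σ(u)}−t_{σ(u−1)}) ) · e_1∧e_2∧…∧e_n. -/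
/-- Replacing every vector but the first by its difference with its predecessor does not change
the value of an alternating map. -/
theorem AlternatingMap.map_sub_pred {R M N : Type*} [CommRing R] [AddCommGroup M] [Module R M]
    [AddCommGroup N] [Module R N] {n : ℕ} (f : M [⋀^Fin n]→ₗ[R] N) (w : Fin n → M) :
    f (fun u => w u - (if (u : ℕ) = 0 then 0
      else w ⟨(u : ℕ) - 1, Nat.lt_of_le_of_lt (Nat.sub_le _ _) u.isLt⟩)) = f w := by
  let pred : Fin n → M := fun u => if (u : ℕ) = 0 then 0
    else w ⟨(u : ℕ) - 1, Nat.lt_of_le_of_lt (Nat.sub_le _ _) u.isLt⟩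
  let g : ℕ → Fin n → M := fun k u => w u - if k ≤ (u : ℕ) then pred u else 0
  have step : ∀ k, k < n → f (g k) = f (g (k + 1)) := by
    intro k hk
    have hg : g k = Function.update (g (k + 1)) ⟨k, hk⟩ (w ⟨k, hk⟩ - pred ⟨k, hk⟩) := by
      funext u
      rcases eq_or_ne u ⟨k, hk⟩ with rfl | hu
      · simp [g]
      · have hne : (u : ℕ) ≠ k := fun h => hu (Fin.ext h)
        have hiff : k ≤ (u : ℕ) ↔ k + 1 ≤ (u : ℕ) := by omega
        simp only [g, Function.update_of_ne hu, hiff]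
    have hw : Function.update (g (k + 1)) ⟨k, hk⟩ (w ⟨k, hk⟩) = g (k + 1) := by
      rw [Function.update_eq_self_iff]
      simp [g]
    have hpred : f (Function.update (g (k + 1)) ⟨k, hk⟩ (pred ⟨k, hk⟩)) = 0 := by
      by_cases hk0 : k = 0
      · simp [pred, hk0]
      · have hval : pred ⟨k, hk⟩ = g (k + 1) ⟨k - 1, by omega⟩ := by
          have : ¬ k + 1 ≤ k - 1 := by omega
          simp [pred, g, hk0, this]
        rw [hval]
        refine f.map_update_self _ fun h => ?_
        have := congrArg Fin.val h
        simp only at this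
        omega
    rw [hg, f.map_update_sub, hw, hpred, sub_zero]
  have all : ∀ k, k ≤ n → f (g 0) = f (g k) := by
    intro k
    induction k with
    | zero => intro _; rfl
    | succ k ih => intro hk; rw [ih (by omega), step k (by omega)]
  have hn : g n = w := by
    funext u
    simp [g, u.isLt]
  have h0 : g 0 = fun u => w u - pred u := by
    funext u
    simp [g]
  have := all n le_rfl
  rwa [hn, h0] at this


/-- equality of the two expressions for the canonical differential form
(one-color case). In the exterior algebra of `ℂⁿ` (with `e_u` playing the role of `dt_u`,
`t_{σ(0)} := 0` and `e_{σ(0)} := 0`):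
`Σ_σ sgn(σ) ⋀_u (1/(t_{σ(u)}−t_{σ(u−1)})) (e_{σ(u)} − e_{σ(u−1)})
  = (Σ_σ ∏_u 1/(t_{σ(u)}−t_{σ(u−1)})) e₁∧…∧e_n`. -/
theorem canonical_form_pbw_vs_flag (n : ℕ) (hn : 1 ≤ n) (t : Fin n → ℂ)
    (h0 : ∀ i, t i ≠ 0) (hdist : Function.Injective t) :
    ∑ σ : Equiv.Perm (Fin n), ((Equiv.Perm.sign σ : ℤ) •
      (List.ofFn fun u : Fin n =>
        (1 / (t (σ u) -
            (if (u : ℕ) = 0 then 0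
             else t (σ ⟨(u : ℕ) - 1, Nat.lt_of_le_of_lt (Nat.sub_le _ _) u.isLt⟩)))) •
          (ExteriorAlgebra.ι ℂ)
            ((Pi.single (σ u) 1 : Fin n → ℂ) -
              (if (u : ℕ) = 0 then 0
               else (Pi.single (σ ⟨(u : ℕ) - 1, Nat.lt_of_le_of_lt (Nat.sub_le _ _) u.isLt⟩) 1 :
                 Fin n → ℂ)))).prod) =
    (∑ σ : Equiv.Perm (Fin n), ∏ u : Fin n,
        1 / (t (σ u) -
          (if (u : ℕ) = 0 then 0
           else t (σ ⟨(u : ℕ) - 1, Nat.lt_of_le_of_lt (Nat.sub_le _ _) u.isLt⟩)))) •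
      (List.ofFn fun i : Fin n =>
        (ExteriorAlgebra.ι ℂ) (Pi.single i 1 : Fin n → ℂ)).prod := by
  rw [Finset.sum_smul]
  refine Finset.sum_congr rfl fun σ _ => ?_
  simp only [← map_smul]
  rw [← ExteriorAlgebra.ιMulti_apply, ← ExteriorAlgebra.ιMulti_apply,
    ← AlternatingMap.coe_multilinearMap, MultilinearMap.map_smul_univ,
    AlternatingMap.coe_multilinearMap,
    AlternatingMap.map_sub_pred _ (fun u : Fin n => (Pi.single (σ u) 1 : Fin n → ℂ)),
    smul_comm]
  congr 1
  have h := (ExteriorAlgebra.ιMulti ℂ n).map_perm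
    (fun i : Fin n => (Pi.single i 1 : Fin n → ℂ)) σ
  rw [Function.comp_def] at h
  rw [h, Units.smul_def, smul_smul, ← Units.val_mul, Int.units_mul_self, Units.val_one, one_smul]
end

section
/- Residue recursion for the type C_r functions η_{ε_i+ε_j}: let r≥3 and let i, j satisfy 1≤i<j≤r−1. Then, for every choice of the variables other than x := t^{(j)}_2 lying outside a finite union of affine hyperplanes, the rational function x·θ_{i,j} extends regularly to x=0 and lim_{x→0} x·θ_{i,j} = θ_{i,j+1}, where on the right the remaining color-j variable t^{(j)}_1 of θ_{i,j} serves as the single color-j variable of θ_{i,j+1}. -/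
open Finset Filter Topology

/-- The content `c(i,j) = (0^{i−1}, 1^{j−i}, 2^{r−j}, 1)` (1-based colors). -/
def contC (r i j : ℕ) : Fin r → ℕ :=
  fun u => if (u : ℕ) + 1 < i then 0 else if (u : ℕ) + 1 < j then 1
    else if (u : ℕ) + 1 ≤ r - 1 then 2 else 1

/-- The `s`-variables of the type `C_r` function `θ_{i,j}`:
`s⁽ᵘ⁾ = t⁽ᵘ⁾₂` for `j ≤ u ≤ r−1`, `s⁽ᵘ⁾ = t⁽ᵘ⁾₁` for `i ≤ u ≤ j−1`, `s⁽ʳ⁾ = t⁽ʳ⁾₁`. -/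
noncomputable def svC (r i j : ℕ) (π : ∀ u, Equiv.Perm (Fin (contC r i j u)))
    (t : SVars r (contC r i j) → ℂ) (u : ℕ) : ℂ :=
  if u < j then tvp r (contC r i j) π t u 1
  else if u ≤ r - 1 then tvp r (contC r i j) π t u 2
  else tvp r (contC r i j) π t r 1

/-- The type `C_r` function `θ_{i,j} = η_{ε_i+ε_j}`. -/
noncomputable def thetaC (r i j : ℕ) (t : SVars r (contC r i j) → ℂ) : ℂ :=
  ∑ π : ∀ u, Equiv.Perm (Fin (contC r i j u)),
    (tvp r _ π t j 1 *
      (∏ u ∈ Finset.Icc (j + 1) r, (tvp r _ π t u 1 - tvp r _ π t (u - 1) 1)) *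
      (∏ u ∈ Finset.Icc i (r - 1), (svC r i j π t u - svC r i j π t (u + 1))))⁻¹

lemma tvp_of_lt {r : ℕ} {k : Fin r → ℕ} (π : ∀ u, Equiv.Perm (Fin (k u))) (t : SVars r k → ℂ)
    {c a : ℕ} (hc : c - 1 < r) (ha : a - 1 < k ⟨c - 1, hc⟩) :
    tvp r k π t c a = t ⟨⟨c - 1, hc⟩, π ⟨c - 1, hc⟩ ⟨a - 1, ha⟩⟩ := by
  simp only [tvp, hc, ha, dif_pos]

lemma continuous_tvp {r : ℕ} {k : Fin r → ℕ} (π : ∀ u, Equiv.Perm (Fin (k u))) (c a : ℕ) :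
    Continuous fun t => tvp r k π t c a := by
  unfold tvp
  split_ifs <;> fun_prop

lemma continuous_svC {r i j : ℕ} (π : ∀ u, Equiv.Perm (Fin (contC r i j u))) (u : ℕ) :
    Continuous fun t => svC r i j π t u := by
  unfold svC
  split_ifs <;> exact continuous_tvp _ _ _

lemma continuous_extendAt {r : ℕ} {k : Fin r → ℕ} (v₀ : SVars r k)
    (s : {v : SVars r k // v ≠ v₀} → ℂ) : Continuous (extendAt r k v₀ s) := by
  refine continuous_pi fun v => ?_
  unfold extendAt
  split_ifs <;> fun_prop

lemma extendAt_self {r : ℕ} {k : Fin r → ℕ} (v₀ : SVars r k)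
    (s : {v : SVars r k // v ≠ v₀} → ℂ) (x : ℂ) : extendAt r k v₀ s x v₀ = x :=
  dif_pos rfl

lemma extendAt_of_ne {r : ℕ} {k : Fin r → ℕ} {v₀ v : SVars r k} (hv : v ≠ v₀)
    (s : {v : SVars r k // v ≠ v₀} → ℂ) (x : ℂ) : extendAt r k v₀ s x v = s ⟨v, hv⟩ :=
  dif_neg hv

/-- Extending an injective nowhere-vanishing assignment by the value `0` keeps it injective. -/
lemma extendAt_zero_injective {r : ℕ} {k : Fin r → ℕ} {v₀ : SVars r k}
    {s : {v : SVars r k // v ≠ v₀} → ℂ} (hs : Function.Injective s) (hs0 : ∀ v, s v ≠ 0) :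
    Function.Injective (extendAt r k v₀ s 0) := by
  intro v w h
  by_cases hv : v = v₀ <;> by_cases hw : w = v₀
  · rw [hv, hw]
  · subst hv
    rw [extendAt_self, extendAt_of_ne hw] at h
    exact absurd h.symm (hs0 _)
  · subst hw
    rw [extendAt_self, extendAt_of_ne hv] at h
    exact absurd h (hs0 _)
  · rw [extendAt_of_ne hv, extendAt_of_ne hw] at h
    exact congrArg Subtype.val (hs h)

lemma extendAt_mk_eq_restrictVar {r : ℕ} {k k' : Fin r → ℕ} (hk : ∀ u, k' u ≤ k u)
    {v₀ : SVars r k} (hv₀ : k' v₀.1 ≤ (v₀.2 : ℕ)) (s : {v : SVars r k // v ≠ v₀} → ℂ) (x : ℂ)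
    (c : Fin r) {b : Fin (k c)} {b' : Fin (k' c)} (hb : (b : ℕ) = b') :
    extendAt r k v₀ s x ⟨c, b⟩ = s (restrictVar r k k' hk v₀ hv₀ ⟨c, b'⟩) := by
  have h : (⟨c, b⟩ : SVars r k) = (restrictVar r k k' hk v₀ hv₀ ⟨c, b'⟩).1 := by
    simp only [restrictVar, ← hb]
  rw [h, extendAt_of_ne (restrictVar r k k' hk v₀ hv₀ ⟨c, b'⟩).2]

/-- Finitely many hyperplanes outside of which an assignment is injective and nowhere zero. -/
lemma exists_hyperplanes_injective (ι : Type*) [Finite ι] :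
    ∃ N : Finset (((ι → ℂ) →ₗ[ℂ] ℂ) × ℂ), (∀ q ∈ N, q.1 ≠ 0) ∧
      ∀ s : ι → ℂ, (∀ q ∈ N, q.1 s ≠ q.2) → Function.Injective s ∧ ∀ v, s v ≠ 0 := by
  classical
  have := Fintype.ofFinite ι
  let p (v : ι) : (ι → ℂ) →ₗ[ℂ] ℂ := LinearMap.proj v
  refine ⟨univ.image (fun v => (p v, 0)) ∪
    (univ.filter fun vw : ι × ι => vw.1 ≠ vw.2).image (fun vw => (p vw.1 - p vw.2, 0)), ?_, ?_⟩
  · intro q hq h0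
    simp only [mem_union, mem_image, mem_univ, true_and, mem_filter] at hq
    rcases hq with ⟨v, rfl⟩ | ⟨⟨v, w⟩, hvw, rfl⟩
    · simpa [p] using LinearMap.congr_fun h0 (Pi.single v 1)
    · have h := LinearMap.congr_fun h0 (Pi.single v 1)
      simp [p, Pi.single_eq_of_ne (Ne.symm hvw)] at h
  · intro s hs
    refine ⟨fun v w h => ?_, fun v => ?_⟩
    · by_contra hvw
      refine hs (p v - p w, 0) (mem_union_right _ (mem_image.2 ⟨(v, w), ?_, rfl⟩)) ?_
      · simpa using hvw
      · simp [p, h]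
    · exact hs (p v, 0) (mem_union_left _ (mem_image_of_mem _ (mem_univ v)))

/-- The denominator of a summand of `thetaC` without its factor `t⁽ʲ⁾₁`. -/
noncomputable def tailC (r i j : ℕ) (π : ∀ u, Equiv.Perm (Fin (contC r i j u)))
    (t : SVars r (contC r i j) → ℂ) : ℂ :=
  (∏ u ∈ Finset.Icc (j + 1) r, (tvp r _ π t u 1 - tvp r _ π t (u - 1) 1)) *
    (∏ u ∈ Finset.Icc i (r - 1), (svC r i j π t u - svC r i j π t (u + 1)))

lemma thetaC_eq_sum_tailC (r i j : ℕ) (t : SVars r (contC r i j) → ℂ) :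
    thetaC r i j t = ∑ π, (tvp r _ π t j 1 * tailC r i j π t)⁻¹ := by
  simp only [thetaC, tailC, mul_assoc]

lemma continuous_tailC {r i j : ℕ} (π : ∀ u, Equiv.Perm (Fin (contC r i j u))) :
    Continuous (tailC r i j π) :=
  (continuous_finsetProd _ fun _ _ => (continuous_tvp _ _ _).sub (continuous_tvp _ _ _)).mul
    (continuous_finsetProd _ fun _ _ => (continuous_svC _ _).sub (continuous_svC _ _))

lemma contC_pos {r i j c : ℕ} (hc : i ≤ c) (h : c - 1 < r) : 1 - 1 < contC r i j ⟨c - 1, h⟩ := by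
  simp only [contC]; split_ifs <;> omega

lemma contC_two {r i j c : ℕ} (hij : i < j) (hjc : j ≤ c) (hc : c ≤ r - 1) (h : c - 1 < r) :
    2 - 1 < contC r i j ⟨c - 1, h⟩ := by
  simp only [contC]; split_ifs <;> omega

lemma svC_eq_apply {r i j u : ℕ} (π : ∀ u, Equiv.Perm (Fin (contC r i j u)))
    (t : SVars r (contC r i j) → ℂ) (hij : i < j) (hu : i ≤ u) (hur : u ≤ r)
    (h : u - 1 < r) : ∃ b, svC r i j π t u = t ⟨⟨u - 1, h⟩, b⟩ := by
  unfold svC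
  split_ifs with h1 h2
  · exact ⟨_, tvp_of_lt π t h (contC_pos hu h)⟩
  · exact ⟨_, tvp_of_lt π t h (contC_two hij (by omega) h2 h)⟩
  · obtain rfl : u = r := by omega
    exact ⟨_, tvp_of_lt π t h (contC_pos hu h)⟩

lemma tailC_ne_zero {r i j : ℕ} (π : ∀ u, Equiv.Perm (Fin (contC r i j u)))
    {t : SVars r (contC r i j) → ℂ} (ht : Function.Injective t) (hi : 1 ≤ i) (hij : i < j) :
    tailC r i j π t ≠ 0 := by
  have key (c c' : Fin r) (hcc : c ≠ c') (b b') : t ⟨c, b⟩ - t ⟨c', b'⟩ ≠ 0 :=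
    sub_ne_zero.2 fun h => hcc (congrArg Sigma.fst (ht h))
  refine mul_ne_zero (prod_ne_zero_iff.2 fun u hu => ?_) (prod_ne_zero_iff.2 fun u hu => ?_)
  · rw [mem_Icc] at hu
    rw [tvp_of_lt π t (by omega) (contC_pos (by omega) _),
      tvp_of_lt π t (by omega) (contC_pos (by omega) _)]
    refine key _ _ ?_ _ _
    simp only [ne_eq, Fin.mk.injEq]; omega
  · rw [mem_Icc] at hu
    obtain ⟨b, hb⟩ := svC_eq_apply π t hij hu.1 (by omega) (by omega)
    obtain ⟨b', hb'⟩ := svC_eq_apply (u := u + 1) π t hij (by omega) (by omega) (by omega)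
    rw [hb, hb']
    refine key _ _ ?_ _ _
    simp only [ne_eq, Fin.mk.injEq]; omega

/-- Extend a family of permutations to larger contents, reversing the lower indices of each
color whose content changes. -/
def liftPerm {r : ℕ} {k k' : Fin r → ℕ} (π : ∀ u, Equiv.Perm (Fin (k' u))) (u : Fin r) :
    Equiv.Perm (Fin (k u)) :=
  if h : k' u = k u then (finCongr h).permCongr (π u) else Fin.revPerm

lemma liftPerm_injective {r : ℕ} {k k' : Fin r → ℕ} (hk : ∀ u, k' u = k u ∨ k' u ≤ 1) :
    Function.Injective (liftPerm (k := k) (k' := k')) := by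
  intro π₁ π₂ h
  funext u
  have hu := congrFun h u
  by_cases hc : k' u = k u
  · simpa only [liftPerm, dif_pos hc, EmbeddingLike.apply_eq_iff_eq] using hu
  · have : Subsingleton (Fin (k' u)) := Fin.subsingleton_iff_le_one.2 ((hk u).resolve_left hc)
    exact Subsingleton.elim _ _

lemma perm_eq_revPerm_of_two {n : ℕ} (hn : n = 2) (σ : Equiv.Perm (Fin n))
    (hσ : σ ⟨0, by omega⟩ = ⟨1, by omega⟩) : σ = Fin.revPerm := by
  subst hn
  revert hσ
  revert σ
  decide

lemma mem_range_liftPerm {r : ℕ} {k k' : Fin r → ℕ} (π : ∀ u, Equiv.Perm (Fin (k u)))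
    (hπ : ∀ u, k' u ≠ k u → π u = Fin.revPerm) :
    π ∈ Set.range (liftPerm (k := k) (k' := k')) := by
  refine ⟨fun u => if h : k' u = k u then (finCongr h).permCongr.symm (π u) else 1, ?_⟩
  funext u
  by_cases h : k' u = k u
  · simp only [liftPerm, dif_pos h, Equiv.apply_symm_apply]
  · simp only [liftPerm, dif_neg h, hπ u h]

lemma tvp_liftPerm {r : ℕ} {k k' : Fin r → ℕ} (hk : ∀ u, k' u ≤ k u) {v₀ : SVars r k}
    (hv₀ : k' v₀.1 ≤ (v₀.2 : ℕ)) (s : {v : SVars r k // v ≠ v₀} → ℂ) (x : ℂ)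
    (π : ∀ u, Equiv.Perm (Fin (k' u))) {c a : ℕ} (hc : c - 1 < r)
    (hkc : k' ⟨c - 1, hc⟩ = k ⟨c - 1, hc⟩) (ha : a - 1 < k' ⟨c - 1, hc⟩) :
    tvp r k (liftPerm π) (extendAt r k v₀ s x) c a =
      tvp r k' π (fun v => s (restrictVar r k k' hk v₀ hv₀ v)) c a := by
  rw [tvp_of_lt _ _ hc (hkc ▸ ha), tvp_of_lt _ _ hc ha]
  apply extendAt_mk_eq_restrictVar hk hv₀
  simp only [liftPerm, dif_pos hkc]
  simp [Equiv.permCongr_apply]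

lemma contC_succ_eq {r i j : ℕ} {c : ℕ} (hc : 1 ≤ c) (hcj : c ≠ j)
    (h : c - 1 < r) : contC r i (j + 1) ⟨c - 1, h⟩ = contC r i j ⟨c - 1, h⟩ := by
  simp only [contC]; split_ifs <;> omega

lemma contC_self {r i j : ℕ} (hij : i < j) (hj : j ≤ r - 1) (h : j - 1 < r) :
    contC r i j ⟨j - 1, h⟩ = 2 := by
  simp only [contC]; split_ifs <;> omega

lemma contC_succ_self {r i j : ℕ} (hij : i < j) (h : j - 1 < r) :
    contC r i (j + 1) ⟨j - 1, h⟩ = 1 := by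
  simp only [contC]; split_ifs <;> omega

lemma liftPerm_contC_self {r i j : ℕ} (hij : i < j) (hj : j ≤ r - 1) (hjr : j - 1 < r)
    (π : ∀ u, Equiv.Perm (Fin (contC r i (j + 1) u))) :
    liftPerm (k := contC r i j) π ⟨j - 1, hjr⟩ = Fin.revPerm := by
  refine dif_neg ?_
  simp only [contC_self hij hj, contC_succ_self hij]
  decide

lemma tvp_self_one {r i j : ℕ} (hij : i < j) (hjr : j - 1 < r)
    (hone : 1 < contC r i j ⟨j - 1, hjr⟩) (π : ∀ u, Equiv.Perm (Fin (contC r i j u)))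
    (hπ : π ⟨j - 1, hjr⟩ ⟨0, by omega⟩ = ⟨1, hone⟩)
    (s : {v : SVars r (contC r i j) // v ≠ ⟨⟨j - 1, hjr⟩, ⟨1, hone⟩⟩} → ℂ) (x : ℂ) :
    tvp r _ π (extendAt r _ _ s x) j 1 = x := by
  rw [tvp_of_lt _ _ hjr (contC_pos hij.le _)]
  exact (congrArg (fun b => extendAt r _ _ s x ⟨_, b⟩) hπ).trans (extendAt_self _ s x)

lemma liftPerm_self_zero {r i j : ℕ} (hij : i < j) (hj : j ≤ r - 1) (hjr : j - 1 < r)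
    (hone : 1 < contC r i j ⟨j - 1, hjr⟩) (π : ∀ u, Equiv.Perm (Fin (contC r i (j + 1) u))) :
    liftPerm (k := contC r i j) π ⟨j - 1, hjr⟩ ⟨0, by omega⟩ = ⟨1, hone⟩ := by
  rw [liftPerm_contC_self hij hj]
  ext
  simp [contC_self hij hj]

lemma tailC_liftPerm {r i j : ℕ} (hi : 1 ≤ i) (hij : i < j) (hj : j ≤ r - 1) (hjr : j - 1 < r)
    (hone : 1 < contC r i j ⟨j - 1, hjr⟩) (hk : ∀ u, contC r i (j + 1) u ≤ contC r i j u)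
    (hv₀ : contC r i (j + 1) ⟨j - 1, hjr⟩ ≤ 1)
    (s : {v : SVars r (contC r i j) // v ≠ ⟨⟨j - 1, hjr⟩, ⟨1, hone⟩⟩} → ℂ)
    (π : ∀ u, Equiv.Perm (Fin (contC r i (j + 1) u))) :
    tailC r i j (liftPerm π) (extendAt r (contC r i j) ⟨⟨j - 1, hjr⟩, ⟨1, hone⟩⟩ s 0) =
      tvp r _ π (fun v => s (restrictVar r _ _ hk ⟨⟨j - 1, hjr⟩, ⟨1, hone⟩⟩ hv₀ v)) (j + 1) 1 *
        tailC r i (j + 1) π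
          (fun v => s (restrictVar r _ _ hk ⟨⟨j - 1, hjr⟩, ⟨1, hone⟩⟩ hv₀ v)) := by
  have htv {c a : ℕ} (hc1 : 1 ≤ c) (hcj : c ≠ j) (hcr : c - 1 < r)
      (ha : a - 1 < contC r i (j + 1) ⟨c - 1, hcr⟩) :=
    tvp_liftPerm hk (v₀ := ⟨⟨j - 1, hjr⟩, ⟨1, hone⟩⟩) hv₀ s 0 π hcr
      (contC_succ_eq hc1 hcj hcr) ha
  have hsv {u : ℕ} (hiu : i ≤ u) (hur : u ≤ r) :
      svC r i j (liftPerm π) (extendAt r _ ⟨⟨j - 1, hjr⟩, ⟨1, hone⟩⟩ s 0) u =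
        svC r i (j + 1) π
          (fun v => s (restrictVar r _ _ hk ⟨⟨j - 1, hjr⟩, ⟨1, hone⟩⟩ hv₀ v)) u := by
    rcases lt_trichotomy u j with huj | rfl | huj
    · rw [svC, svC, if_pos huj, if_pos (by omega)]
      exact htv (by omega) (by omega) (by omega) (contC_pos hiu _)
    · rw [svC, svC, if_neg (by omega), if_pos hj, if_pos (by omega),
        tvp_of_lt _ _ hjr (by omega), tvp_of_lt _ _ hjr (contC_pos hiu _)]
      apply extendAt_mk_eq_restrictVar hk (v₀ := ⟨⟨u - 1, hjr⟩, ⟨1, hone⟩⟩) hv₀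
      rw [liftPerm_contC_self hij hj]
      have h1 := (π ⟨u - 1, hjr⟩ ⟨1 - 1, contC_pos hiu hjr⟩).isLt
      simp only [Fin.revPerm_apply, Fin.val_rev, contC_self hij hj]
      omega
    · rw [svC, svC, if_neg (by omega), if_neg (by omega : ¬u < j + 1)]
      by_cases hu : u ≤ r - 1
      · rw [if_pos hu, if_pos hu]
        exact htv (by omega) (by omega) (by omega) (contC_two (by omega) huj hu _)
      · rw [if_neg hu, if_neg hu]
        exact htv (by omega) (by omega) (by omega) (contC_pos (by omega) _)
  rw [tailC, tailC, ← mul_assoc, ← mul_prod_Ioc_eq_prod_Icc (by omega : j + 1 ≤ r),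
    ← Icc_add_one_left_eq_Ioc, Nat.add_sub_cancel,
    tvp_self_one hij hjr hone _ (liftPerm_self_zero hij hj hjr hone π), sub_zero,
    htv (by omega) (by omega) (by omega) (contC_pos (by omega) _)]
  congr 1
  · congr 1
    refine prod_congr rfl fun u hu => ?_
    rw [mem_Icc] at hu
    rw [htv (by omega) (by omega) (by omega) (contC_pos (by omega) _),
      htv (by omega) (by omega) (by omega) (contC_pos (by omega) _)]
  · refine prod_congr rfl fun u hu => ?_
    rw [mem_Icc] at hu
    rw [hsv hu.1 (by omega), hsv (by omega) (by omega)]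

/-- residue recursion for the type `C_r` functions `η_{ε_i+ε_j}`: for
`r ≥ 3` and `1 ≤ i < j ≤ r−1`, generically in the variables other than `x := t^{(j)}_2`,
the function `x·θ_{i,j}` extends regularly to `x = 0` with limit `θ_{i,j+1}` (the
remaining color-`j` variable `t^{(j)}_1` serving as the single color-`j` variable of
`θ_{i,j+1}`). -/
theorem residue_recursion_C_theta (r : ℕ) (hr : 3 ≤ r) (i j : ℕ)
    (hi : 1 ≤ i) (hij : i < j) (hj : j ≤ r - 1) :
    ∃ N : Finset ((({v : SVars r (contC r i j) //
          v ≠ ⟨⟨j - 1, by omega⟩, ⟨1, by simp only [contC]; split_ifs <;> omega⟩⟩} → ℂ)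
            →ₗ[ℂ] ℂ) × ℂ),
      (∀ q ∈ N, q.1 ≠ 0) ∧
      ∀ s : {v : SVars r (contC r i j) //
          v ≠ ⟨⟨j - 1, by omega⟩, ⟨1, by simp only [contC]; split_ifs <;> omega⟩⟩} → ℂ,
        (∀ q ∈ N, q.1 s ≠ q.2) →
        Tendsto
          (fun x : ℂ => x * thetaC r i j (extendAt r (contC r i j) _ s x))
          (𝓝[≠] (0 : ℂ))
          (𝓝 (thetaC r i (j + 1) (fun v => s (restrictVar r (contC r i j) (contC r i (j + 1))
            (by intro u; simp only [contC]; split_ifs <;> omega)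
            ⟨⟨j - 1, by omega⟩, ⟨1, by simp only [contC]; split_ifs <;> omega⟩⟩
            (by simp only [contC]; split_ifs <;> omega) v)))) := by
  classical
  have hjr : j - 1 < r := by omega
  have hone : 1 < contC r i j ⟨j - 1, hjr⟩ := by rw [contC_self hij hj]; decide
  obtain ⟨N, hN, hgen⟩ := exists_hyperplanes_injective
    {v : SVars r (contC r i j) // v ≠ ⟨⟨j - 1, hjr⟩, ⟨1, hone⟩⟩}
  refine ⟨N, hN, fun s hs => ?_⟩
  obtain ⟨hinj, hs0⟩ := hgen s hs
  have hT := extendAt_zero_injective hinj hs0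
  have hcont := continuous_extendAt ⟨⟨j - 1, hjr⟩, ⟨1, hone⟩⟩ s
  have htail (π) : Tendsto (fun x => tailC r i j π (extendAt r _ _ s x)) (𝓝[≠] 0)
      (𝓝 (tailC r i j π (extendAt r _ _ s 0))) :=
    ((continuous_tailC π).comp hcont).continuousAt.tendsto.mono_left nhdsWithin_le_nhds
  have hterm (π : ∀ u, Equiv.Perm (Fin (contC r i j u))) :
      Tendsto (fun x => x * (tvp r _ π (extendAt r _ _ s x) j 1 *
          tailC r i j π (extendAt r _ _ s x))⁻¹) (𝓝[≠] 0)
        (𝓝 (if π ⟨j - 1, hjr⟩ ⟨0, by omega⟩ = ⟨1, hone⟩ then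
          (tailC r i j π (extendAt r _ _ s 0))⁻¹ else 0)) := by
    by_cases hπ : π ⟨j - 1, hjr⟩ ⟨0, by omega⟩ = ⟨1, hone⟩
    · rw [if_pos hπ]
      refine ((htail π).inv₀ (tailC_ne_zero π hT hi hij)).congr' ?_
      filter_upwards [self_mem_nhdsWithin] with x hx
      rw [tvp_self_one hij hjr hone π hπ, mul_inv, mul_inv_cancel_left₀ hx]
    · rw [if_neg hπ]
      have hne : tvp r _ π (extendAt r _ _ s 0) j 1 ≠ 0 := by
        rw [tvp_of_lt _ _ hjr (contC_pos hij.le _), extendAt_of_ne]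
        · exact hs0 _
        · exact fun h => hπ (eq_of_heq (Sigma.mk.inj h).2)
      have htv : Tendsto (fun x => tvp r _ π (extendAt r _ _ s x) j 1) (𝓝[≠] 0)
          (𝓝 (tvp r _ π (extendAt r _ _ s 0) j 1)) :=
        ((continuous_tvp π j 1).comp hcont).continuousAt.tendsto.mono_left nhdsWithin_le_nhds
      have hx : Tendsto (fun x : ℂ => x) (𝓝[≠] 0) (𝓝 0) := tendsto_id.mono_left nhdsWithin_le_nhds
      simpa only [zero_mul] using hx.mul ((htv.mul (htail π)).inv₀
        (mul_ne_zero hne (tailC_ne_zero π hT hi hij)))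
  simp only [thetaC_eq_sum_tailC, mul_sum]
  convert tendsto_finsetSum univ fun π _ => hterm π using 2
  have hcases (u : Fin r) (hu : contC r i (j + 1) u ≠ contC r i j u) : u = ⟨j - 1, hjr⟩ := by
    by_contra h
    refine hu (contC_succ_eq (c := u + 1) (by omega) ?_ (by omega))
    intro h'
    exact h (Fin.ext (by simp; omega))
  refine sum_of_injOn (liftPerm (k := contC r i j)) (liftPerm_injective fun u => ?_).injOn
    (fun _ _ => mem_coe.2 (mem_univ _)) (fun π _ hπ => if_neg fun h => hπ ?_) fun π _ => ?_
  · refine or_iff_not_imp_left.2 fun hu => ?_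
    rw [hcases u hu, contC_succ_self hij]
  · rw [coe_univ, Set.image_univ]
    refine mem_range_liftPerm π fun u hu => ?_
    obtain rfl := hcases u hu
    exact perm_eq_revPerm_of_two (contC_self hij hj hjr) _ h
  · rw [if_pos (liftPerm_self_zero hij hj hjr hone π), tailC_liftPerm hi hij hj]
end
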